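/- Let W be a semigroup equipped with a binary relation ≺ satisfying: (A1) ≺ is transitive; (A2) ≺ is asymmetric; (A3) incomparability (neither x ≺ y nor y ≺ x) is transitive; (A5) for all x, y, z, x ≺ y iff x*z ≺ y*z iff z*x ≺ z*y. Call x positive if x ≺ x*x and negative if x*x ≺ x, and suppose W is non-anomalous with respect to ≺: there are no elements with y ≺ x such that either xⁿ ≺ y^(n+1) for all n ≥ 1 or y^(n+1) ≺ xⁿ... i.e. no pair y ≺ x with xⁿ ≺ y^(n+1) for every n ≥ 1 nor a pair y ≺ x with x^(n+1) ≺ yⁿ for every n ≥ 1. Then there exist a non-anomalous totally ordered semigroup V and a map q : W → V such that q(x*y) = q(x)*q(y) for all x, y and x ≺ y implies q(x) < q(y). -/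

import Mathlib

/-- `mpow x n` is the `n`-fold product `xⁿ` of `x` with itself, for `n ≥ 1`
(the value at `n = 0` is a junk value, never used below). -/
def mpow {S : Type*} [Mul S] (x : S) : ℕ → S
  | 0 => x
  | 1 => x
  | n + 2 => mpow x (n + 1) * x

/-- `x, y` with `x > y` form an anomalous pair if `xⁿ < y^(n+1)` for every `n ≥ 1`,
or `yⁿ > x^(n+1)` for every `n ≥ 1`. -/
def IsAnomalousPair {S : Type*} [Mul S] [LT S] (x y : S) : Prop :=
  y < x ∧ ((∀ n : ℕ, 1 ≤ n → mpow x n < mpow y (n + 1)) ∨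
           (∀ n : ℕ, 1 ≤ n → mpow x (n + 1) < mpow y n))

/-- A bundled non-anomalous totally ordered semigroup. -/
structure NATOSemigroup where
  carrier : Type*
  [sg : Semigroup carrier]
  [lo : LinearOrder carrier]
  mul_lt : ∀ x y z : carrier, x < y → x * z < y * z ∧ z * x < z * y
  nonAnom : ∀ x y : carrier, ¬ IsAnomalousPair x y

attribute [instance] NATOSemigroup.sg NATOSemigroup.lo

section Powers

variable {S : Type*} [Semigroup S]

theorem mpow_succ (x : S) {n : ℕ} (hn : 1 ≤ n) : mpow x (n + 1) = mpow x n * x := by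
  obtain ⟨n, rfl⟩ := Nat.exists_eq_add_of_le' hn
  rfl

theorem mpow_add (x : S) {m n : ℕ} (hm : 1 ≤ m) (hn : 1 ≤ n) :
    mpow x (m + n) = mpow x m * mpow x n := by
  induction n, hn using Nat.le_induction with
  | base => exact mpow_succ x hm
  | succ n hn ih => rw [← add_assoc, mpow_succ x (by omega), ih, mpow_succ x hn, mul_assoc]

theorem mpow_succ' (x : S) {n : ℕ} (hn : 1 ≤ n) : mpow x (n + 1) = x * mpow x n := by
  rw [add_comm, mpow_add x le_rfl hn]
  rfl

theorem mpow_mul (x : S) {m n : ℕ} (hm : 1 ≤ m) (hn : 1 ≤ n) :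
    mpow x (m * n) = mpow (mpow x m) n := by
  induction n, hn using Nat.le_induction with
  | base => rw [mul_one]; rfl
  | succ n hn ih => rw [mul_add, mul_one, mpow_add x (Nat.mul_pos hm hn) hm, ih, mpow_succ _ hn]

theorem mpow_orderDual (x : S) (n : ℕ) :
    mpow (OrderDual.toDual x) n = OrderDual.toDual (mpow x n) := by
  rcases Nat.eq_zero_or_pos n with rfl | hn
  · rfl
  induction n, hn using Nat.le_induction with
  | base => rfl
  | succ n hn ih => rw [mpow_succ _ hn, ih, mpow_succ _ hn]; rfl

theorem map_mpow {f : S → ℝ} (hf : ∀ x y, f (x * y) = f x + f y) (x : S) {n : ℕ}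
    (hn : 1 ≤ n) : f (mpow x n) = n * f x := by
  induction n, hn using Nat.le_induction with
  | base => simp [mpow]
  | succ n hn ih => rw [mpow_succ x hn, hf, ih]; push_cast; ring

end Powers

theorem nonpos_of_forall_nat_mul_le {a b : ℝ} (h : ∀ n : ℕ, 1 ≤ n → n * a ≤ b) : a ≤ 0 := by
  by_contra! ha
  obtain ⟨n, hn⟩ := exists_nat_gt (b / a)
  rw [div_lt_iff₀ ha] at hn
  have := h (n + 1) (by omega)
  push_cast at this
  linarith

/-- A total preorder on a semigroup for which translations preserve and reflect the order, and
which has no anomalous pairs. -/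
class NonAnomalousPreorder (S : Type*) [Semigroup S] [Preorder S] : Prop where
  total : ∀ x y : S, x ≤ y ∨ y ≤ x
  mul_le_mul_left_iff : ∀ x y z : S, z * x ≤ z * y ↔ x ≤ y
  mul_le_mul_right_iff : ∀ x y z : S, x * z ≤ y * z ↔ x ≤ y
  exists_mpow_succ_le : ∀ x y : S, x < y → ∃ n, 1 ≤ n ∧ mpow x (n + 1) ≤ mpow y n
  exists_mpow_le_succ : ∀ x y : S, x < y → ∃ n, 1 ≤ n ∧ mpow x n ≤ mpow y (n + 1)

namespace NonAnomalousPreorder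

variable {S : Type*} [Semigroup S] [Preorder S] [NonAnomalousPreorder S]

instance : MulLeftMono S := ⟨fun z x y h => (mul_le_mul_left_iff x y z).2 h⟩

instance : MulRightMono S := ⟨fun z x y h => (mul_le_mul_right_iff x y z).2 h⟩

instance : NonAnomalousPreorder Sᵒᵈ where
  total x y := total (S := S) (OrderDual.ofDual y) (OrderDual.ofDual x)
  mul_le_mul_left_iff x y z :=
    mul_le_mul_left_iff (S := S) (OrderDual.ofDual y) (OrderDual.ofDual x) (OrderDual.ofDual z)
  mul_le_mul_right_iff x y z :=
    mul_le_mul_right_iff (S := S) (OrderDual.ofDual y) (OrderDual.ofDual x) (OrderDual.ofDual z)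
  exists_mpow_succ_le x y h := by
    obtain ⟨n, hn, H⟩ := exists_mpow_le_succ (S := S) (OrderDual.ofDual y) (OrderDual.ofDual x) h
    refine ⟨n, hn, ?_⟩
    rw [← OrderDual.toDual_ofDual x, ← OrderDual.toDual_ofDual y, mpow_orderDual, mpow_orderDual]
    exact H
  exists_mpow_le_succ x y h := by
    obtain ⟨n, hn, H⟩ := exists_mpow_succ_le (S := S) (OrderDual.ofDual y) (OrderDual.ofDual x) h
    refine ⟨n, hn, ?_⟩
    rw [← OrderDual.toDual_ofDual x, ← OrderDual.toDual_ofDual y, mpow_orderDual, mpow_orderDual]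
    exact H

theorem lt_of_not_le {x y : S} (h : ¬ x ≤ y) : y < x :=
  lt_of_le_not_ge ((total x y).resolve_left h) h

theorem le_mul_right_iff_le_mul_left (x u z : S) : x ≤ x * u ↔ z ≤ u * z := by
  rw [← mul_le_mul_right_iff x (x * u) z, mul_assoc, mul_le_mul_left_iff]

theorem mul_right_le_iff_mul_left_le (x u z : S) : x * u ≤ x ↔ u * z ≤ z := by
  rw [← mul_le_mul_right_iff (x * u) x z, mul_assoc, mul_le_mul_left_iff]

theorem lt_mul_left {c : S} (hc : c < c * c) (x : S) : x < c * x := by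
  rw [lt_iff_le_not_ge] at hc ⊢
  rwa [← le_mul_right_iff_le_mul_left c c x, ← mul_right_le_iff_mul_left_le c c x]

theorem lt_mul_right {c : S} (hc : c < c * c) (x : S) : x < x * c := by
  rw [lt_iff_le_not_ge] at hc ⊢
  rwa [le_mul_right_iff_le_mul_left x c c, mul_right_le_iff_mul_left_le x c c]

theorem mpow_le_mpow {x y : S} (h : x ≤ y) (n : ℕ) : mpow x n ≤ mpow y n := by
  rcases Nat.eq_zero_or_pos n with rfl | hn
  · exact h
  induction n, hn using Nat.le_induction with
  | base => exact h
  | succ n hn ih => rw [mpow_succ _ hn, mpow_succ _ hn]; exact mul_le_mul' ih h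

theorem mpow_mul_le {x y : S} (h : y * x ≤ x * y) {n : ℕ} (hn : 1 ≤ n) :
    mpow y n * x ≤ x * mpow y n := by
  induction n, hn using Nat.le_induction with
  | base => exact h
  | succ n hn ih =>
    calc mpow y (n + 1) * x = mpow y n * (y * x) := by rw [mpow_succ _ hn, mul_assoc]
      _ ≤ mpow y n * (x * y) := mul_le_mul_right h _
      _ = mpow y n * x * y := (mul_assoc _ _ _).symm
      _ ≤ x * mpow y n * y := mul_le_mul_left ih _
      _ = x * mpow y (n + 1) := by rw [mpow_succ _ hn, mul_assoc]

theorem mul_mpow_le {x y : S} (h : y * x ≤ x * y) {n : ℕ} (hn : 1 ≤ n) :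
    mpow (x * y) n ≤ mpow x n * mpow y n := by
  induction n, hn using Nat.le_induction with
  | base => exact le_rfl
  | succ n hn ih =>
    calc mpow (x * y) (n + 1) = mpow (x * y) n * (x * y) := mpow_succ _ hn
      _ ≤ mpow x n * mpow y n * (x * y) := mul_le_mul_left ih _
      _ = mpow x n * (mpow y n * x) * y := by simp only [mul_assoc]
      _ ≤ mpow x n * (x * mpow y n) * y :=
        mul_le_mul_left (mul_le_mul_right (mpow_mul_le h hn) _) _
      _ = mpow x (n + 1) * mpow y (n + 1) := by
        rw [mpow_succ _ hn, mpow_succ _ hn]; simp only [mul_assoc]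

theorem le_mul_mpow {x y : S} (h : x * y ≤ y * x) {n : ℕ} (hn : 1 ≤ n) :
    mpow x n * mpow y n ≤ mpow (x * y) n := by
  have H := mul_mpow_le (S := Sᵒᵈ) (x := OrderDual.toDual x) (y := OrderDual.toDual y) h hn
  rw [← toDual_mul, mpow_orderDual, mpow_orderDual, mpow_orderDual] at H
  exact H

theorem exists_le_mpow {c : S} (hc : c < c * c) (x : S) : ∃ n, 1 ≤ n ∧ x ≤ mpow c n := by
  rcases total (x * c) (c * x) with h | h
  · obtain ⟨n, hn, H⟩ := exists_mpow_succ_le _ _ (lt_mul_left hc x)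
    refine ⟨n, hn, (mul_le_mul_right_iff _ _ (mpow x n)).1 ?_⟩
    rw [← mpow_succ' _ hn]
    exact H.trans (mul_mpow_le h hn)
  · obtain ⟨n, hn, H⟩ := exists_mpow_succ_le _ _ (lt_mul_right hc x)
    refine ⟨n, hn, (mul_le_mul_left_iff _ _ (mpow x n)).1 ?_⟩
    rw [← mpow_succ _ hn]
    exact H.trans (mul_mpow_le h hn)

theorem exists_le_mul_mpow_mul {c : S} (hc : c < c * c) (x : S) :
    ∃ n, 1 ≤ n ∧ ∀ z, z ≤ x * mpow c n * z := by
  rcases total (x * c) (c * x) with h | h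
  · obtain ⟨n, hn, H⟩ := exists_mpow_le_succ _ _ (lt_mul_left hc x)
    refine ⟨n + 1, by omega, fun z => ?_⟩
    have H' := H.trans (mul_mpow_le h (n := n + 1) (by omega))
    rw [mpow_succ' x hn, ← mul_assoc, ← le_mul_right_iff_le_mul_left z] at H'
    rw [← le_mul_right_iff_le_mul_left (z * mpow c (n + 1)), mul_assoc z, ← mul_assoc _ x,
      ← mul_assoc z]
    exact mul_le_mul_left H' _
  · obtain ⟨n, hn, H⟩ := exists_mpow_le_succ _ _ (lt_mul_right hc x)
    refine ⟨n + 1, by omega, fun z => ?_⟩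
    have H' := H.trans (mul_mpow_le h (n := n + 1) (by omega))
    rw [mpow_succ x hn, mul_assoc, le_mul_right_iff_le_mul_left _ _ z] at H'
    exact H'

theorem mpow_lt_mpow {c : S} (hc : c < c * c) {m n : ℕ} (hm : 1 ≤ m) (hmn : m < n) :
    mpow c m < mpow c n := by
  induction n, hmn using Nat.le_induction with
  | base => rw [mpow_succ _ hm]; exact lt_mul_right hc _
  | succ n hn ih => rw [mpow_succ _ (by omega)]; exact ih.trans (lt_mul_right hc _)

theorem le_of_mpow_le_mpow {c : S} (hc : c < c * c) {m n : ℕ} (hn : 1 ≤ n)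
    (h : mpow c m ≤ mpow c n) : m ≤ n :=
  not_lt.1 fun hlt => (mpow_lt_mpow hc hn hlt).not_ge h

theorem exists_floor {c : S} (hc : c < c * c) (x : S) :
    ∃ k j, 1 ≤ k ∧ 1 ≤ j ∧ mpow c k ≤ x * mpow c j ∧ x * mpow c j ≤ mpow c (k + 1) := by
  classical
  obtain ⟨m, hm, H⟩ := exists_le_mul_mpow_mul hc x
  have H := H c
  rw [mul_assoc, ← mpow_succ c hm] at H
  have hex : ∃ n, 1 ≤ n ∧ x * mpow c (m + 1) ≤ mpow c (n + 1) := by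
    obtain ⟨n, hn, h⟩ := exists_le_mpow hc (x * mpow c (m + 1))
    exact ⟨n, hn, h.trans (mpow_lt_mpow hc hn n.lt_succ_self).le⟩
  obtain ⟨h1, h2⟩ := Nat.find_spec hex
  refine ⟨Nat.find hex, m + 1, h1, by omega, ?_, h2⟩
  rcases Nat.lt_or_ge 1 (Nat.find hex) with hlt | hle
  · have hmin := Nat.find_min hex (m := Nat.find hex - 1) (by omega)
    rw [Nat.sub_add_cancel h1] at hmin
    exact (total _ _).resolve_right fun h => hmin ⟨by omega, h⟩
  · rw [le_antisymm hle h1]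
    exact H

theorem mpow_add_le {c x y : S} {k j k' j' : ℕ} (hk : 1 ≤ k) (hj : 1 ≤ j) (hk' : 1 ≤ k')
    (hj' : 1 ≤ j') (h : mpow c k ≤ x * mpow c j) (h' : mpow c k' ≤ y * mpow c j') :
    mpow c (k + k') ≤ x * y * mpow c (j + j') :=
  calc mpow c (k + k') = mpow c k * mpow c k' := mpow_add c hk hk'
    _ ≤ x * mpow c j * mpow c k' := mul_le_mul_left h _
    _ = x * (mpow c k' * mpow c j) := by
      rw [mul_assoc, ← mpow_add c hj hk', ← mpow_add c hk' hj, add_comm]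
    _ ≤ x * (y * mpow c j' * mpow c j) := mul_le_mul_right (mul_le_mul_left h' _) _
    _ = x * y * mpow c (j + j') := by
      rw [add_comm, mpow_add c hj' hj]; simp only [mul_assoc]

theorem le_mpow_add {c x y : S} {k j k' j' : ℕ} (hk : 1 ≤ k) (hj : 1 ≤ j) (hk' : 1 ≤ k')
    (hj' : 1 ≤ j') (h : x * mpow c j ≤ mpow c k) (h' : y * mpow c j' ≤ mpow c k') :
    x * y * mpow c (j + j') ≤ mpow c (k + k') := by
  have H := mpow_add_le (S := Sᵒᵈ) (c := OrderDual.toDual c) (x := OrderDual.toDual x)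
    (y := OrderDual.toDual y) hk hj hk' hj'
  simp only [mpow_orderDual] at H
  exact H h h'

theorem mpow_mul_le_mpow {c x : S} {k j n : ℕ} (hk : 1 ≤ k) (hj : 1 ≤ j) (hn : 1 ≤ n)
    (h : mpow c k ≤ x * mpow c j) : mpow c (k * n) ≤ mpow x n * mpow c (j * n) := by
  induction n, hn using Nat.le_induction with
  | base => simpa [mpow] using h
  | succ n hn ih =>
    rw [mul_add, mul_add, mul_one, mul_one, mpow_succ x hn]
    exact mpow_add_le (Nat.mul_pos hk hn) (Nat.mul_pos hj hn) hk hj ih h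

theorem mpow_le_mpow_mul {c x : S} {k j n : ℕ} (hk : 1 ≤ k) (hj : 1 ≤ j) (hn : 1 ≤ n)
    (h : x * mpow c j ≤ mpow c k) : mpow x n * mpow c (j * n) ≤ mpow c (k * n) := by
  have H := mpow_mul_le_mpow (S := Sᵒᵈ) (c := OrderDual.toDual c) (x := OrderDual.toDual x)
    hk hj hn
  simp only [mpow_orderDual] at H
  exact H h

/-- The size of `x` measured in multiples of a positive element `c`. -/
theorem exists_real {c : S} (hc : c < c * c) (x : S) :
    ∃ q : ℝ, ∀ n k j : ℕ, 1 ≤ n → 1 ≤ k → 1 ≤ j →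
      (mpow c k ≤ mpow x n * mpow c j → (k : ℝ) ≤ n * q + j) ∧
      (mpow x n * mpow c j ≤ mpow c k → n * q + j ≤ (k : ℝ)) := by
  let A : Set ℝ := {t | ∃ n k j : ℕ, 1 ≤ n ∧ 1 ≤ k ∧ 1 ≤ j ∧
    mpow c k ≤ mpow x n * mpow c j ∧ t = ((k : ℝ) - j) / n}
  have hAB : ∀ t ∈ A, ∀ n k j : ℕ, 1 ≤ n → 1 ≤ k → 1 ≤ j →
      mpow x n * mpow c j ≤ mpow c k → t ≤ ((k : ℝ) - j) / n := by
    rintro _ ⟨n', k', j', hn', hk', hj', h', rfl⟩ n k j hn hk hj h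
    have h1 := mpow_mul_le_mpow hk' hj' hn h'
    have h2 := mpow_le_mpow_mul hk hj hn' h
    rw [← mpow_mul x hn' hn] at h1
    rw [← mpow_mul x hn hn', mul_comm n n'] at h2
    have h3 : mpow c (k' * n + j * n') ≤ mpow c (k * n' + j' * n) := by
      rw [mpow_add c (Nat.mul_pos hk' hn) (Nat.mul_pos hj hn'),
        mpow_add c (Nat.mul_pos hk hn') (Nat.mul_pos hj' hn)]
      refine (mul_le_mul_left h1 _).trans ?_
      rw [mul_assoc, ← mpow_add c (Nat.mul_pos hj' hn) (Nat.mul_pos hj hn'), add_comm,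
        mpow_add c (Nat.mul_pos hj hn') (Nat.mul_pos hj' hn), ← mul_assoc]
      exact mul_le_mul_left h2 _
    have h4 := le_of_mpow_le_mpow hc (by nlinarith [Nat.mul_pos hk hn']) h3
    have h5 : (k' * n + j * n' : ℝ) ≤ k * n' + j' * n := by exact_mod_cast h4
    have hn0 : (0 : ℝ) < n := by exact_mod_cast hn
    have hn0' : (0 : ℝ) < n' := by exact_mod_cast hn'
    rw [div_le_div_iff₀ hn0' hn0]
    linarith
  obtain ⟨k₀, j₀, hk₀, hj₀, hl, hu⟩ := exists_floor hc x
  have hne : A.Nonempty := ⟨_, 1, k₀, j₀, le_rfl, hk₀, hj₀, hl, rfl⟩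
  have hbdd : BddAbove A :=
    ⟨_, fun t ht => hAB t ht 1 (k₀ + 1) j₀ le_rfl (by omega) hj₀ hu⟩
  refine ⟨sSup A, fun n k j hn hk hj => ?_⟩
  have hn0 : (0 : ℝ) < n := by exact_mod_cast hn
  constructor
  · intro h
    have H : ((k : ℝ) - j) / n ≤ sSup A := le_csSup hbdd ⟨n, k, j, hn, hk, hj, h, rfl⟩
    rw [div_le_iff₀ hn0] at H
    linarith
  · intro h
    have H : sSup A ≤ ((k : ℝ) - j) / n := csSup_le hne fun t ht => hAB t ht n k j hn hk hj h
    rw [le_div_iff₀ hn0] at H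
    linarith

theorem exists_hom_of_pos {c : S} (hc : c < c * c) :
    ∃ q : S → ℝ, (∀ x y, q (x * y) = q x + q y) ∧ ∀ x y, x < y → q x < q y := by
  choose q hq using exists_real hc
  have hmono : ∀ x y, x ≤ y → q x ≤ q y := fun x y hxy => by
    refine sub_nonpos.1 (nonpos_of_forall_nat_mul_le (b := 1) fun n hn => ?_)
    obtain ⟨k, j, hk, hj, hl, hu⟩ := exists_floor hc (mpow x n)
    have h1 := (hq x n (k + 1) j hn (by omega) hj).2 hu
    have h2 := (hq y n k j hn hk hj).1 (hl.trans (mul_le_mul_left (mpow_le_mpow hxy n) _))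
    push_cast at h1
    linarith
  -- If `x` and `y` commute up to `≤`, then `(x * y) ^ n` lies between `x ^ n * y ^ n` and
  -- `y ^ n * x ^ n`, which differ from the sum of the sizes by a bounded amount.
  have key : ∀ x y, x * y ≤ y * x → ∀ z, (z = x * y ∨ z = y * x) → q z = q x + q y := by
    intro x y hxy z hz
    have hzl : x * y ≤ z := by rcases hz with rfl | rfl <;> first | exact le_rfl | exact hxy
    have hzu : z ≤ y * x := by rcases hz with rfl | rfl <;> first | exact le_rfl | exact hxy
    have bounds : ∀ n : ℕ, 1 ≤ n → n * (q z - (q x + q y)) ≤ 2 ∧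
        n * (q x + q y - q z) ≤ 2 := by
      intro n hn
      obtain ⟨k, j, hk, hj, hl, hu⟩ := exists_floor hc (mpow x n)
      obtain ⟨k', j', hk', hj', hl', hu'⟩ := exists_floor hc (mpow y n)
      have h1 := (hq x n (k + 1) j hn (by omega) hj).2 hu
      have h2 := (hq y n (k' + 1) j' hn (by omega) hj').2 hu'
      have h3 := (hq x n k j hn hk hj).1 hl
      have h4 := (hq y n k' j' hn hk' hj').1 hl'
      have h5 := (hq z n (k + k') (j + j') hn (by omega) (by omega)).1
        ((mpow_add_le hk hj hk' hj' hl hl').trans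
          (mul_le_mul_left ((le_mul_mpow hxy hn).trans (mpow_le_mpow hzl n)) _))
      have h6 := (hq z n (k' + 1 + (k + 1)) (j' + j) hn (by omega) (by omega)).2
        ((mul_le_mul_left ((mpow_le_mpow hzu n).trans (mul_mpow_le hxy hn)) _).trans
          (le_mpow_add (by omega) hj' (by omega) hj hu' hu))
      push_cast at h1 h2 h5 h6
      constructor <;> linarith
    have := nonpos_of_forall_nat_mul_le fun n hn => (bounds n hn).1
    have := nonpos_of_forall_nat_mul_le fun n hn => (bounds n hn).2
    linarith
  have hadd : ∀ x y, q (x * y) = q x + q y := fun x y => by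
    rcases total (x * y) (y * x) with h | h
    · exact key x y h _ (.inl rfl)
    · rw [add_comm]; exact key y x h _ (.inr rfl)
  have hqc : 0 < q c := by
    have h := (hq c 1 2 1 le_rfl (by omega) le_rfl).1 (le_refl (c * c))
    push_cast at h
    linarith
  have hpos : ∀ x, x < x * x → 0 < q x := fun x hx => by
    obtain ⟨n, hn, h⟩ := exists_le_mpow hx c
    have h := hmono _ _ h
    rw [map_mpow hadd x hn] at h
    exact pos_of_mul_pos_right (hqc.trans_le h) n.cast_nonneg
  have hneg : ∀ x, x * x < x → q x < 0 := fun x hx => by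
    obtain ⟨n, hn, h⟩ := exists_le_mul_mpow_mul (S := Sᵒᵈ) (c := OrderDual.toDual x) hx
      (OrderDual.toDual c)
    have h := h (OrderDual.toDual c)
    rw [mpow_orderDual] at h
    have h : q (c * mpow x n * c) ≤ q c := hmono _ _ h
    rw [hadd, hadd, map_mpow hadd x hn] at h
    exact neg_of_mul_neg_right (by linarith : n * q x < 0) n.cast_nonneg
  have hnonneg : ∀ x, x ≤ x * x → 0 ≤ q x := fun x hx => by
    have := hmono _ _ hx
    rw [hadd] at this
    linarith
  have hnonpos : ∀ x, x * x ≤ x → q x ≤ 0 := fun x hx => by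
    have := hmono _ _ hx
    rw [hadd] at this
    linarith
  refine ⟨q, hadd, fun x y hxy => ?_⟩
  by_cases hx : x * x ≤ x
  · by_cases hy : y ≤ y * y
    · by_cases hx' : x ≤ x * x
      · refine (hnonpos x hx).trans_lt (hpos y (lt_of_not_le fun hy' => ?_))
        refine hxy.not_ge ((mul_le_mul_right_iff y x x).1 ?_)
        exact ((mul_right_le_iff_mul_left_le y y x).1 hy').trans hx'
      · exact (hneg x (lt_of_not_le hx')).trans_le (hnonneg y hy)
    · have hy := hneg y (lt_of_not_le hy)
      obtain ⟨n, hn, h⟩ := exists_mpow_le_succ _ _ hxy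
      have h := hmono _ _ h
      rw [map_mpow hadd x hn, map_mpow hadd y (by omega)] at h
      have hn0 : (0 : ℝ) < n := by exact_mod_cast hn
      push_cast at h
      exact lt_of_mul_lt_mul_left (by linarith : n * q x < n * q y) hn0.le
  · have hx := hpos x (lt_of_not_le hx)
    obtain ⟨n, hn, h⟩ := exists_mpow_succ_le _ _ hxy
    have h := hmono _ _ h
    rw [map_mpow hadd x (by omega), map_mpow hadd y hn] at h
    have hn0 : (0 : ℝ) < n := by exact_mod_cast hn
    push_cast at h
    exact lt_of_mul_lt_mul_left (by linarith : n * q x < n * q y) hn0.le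

variable (S) in
/-- A Hölder-type theorem: a totally preordered semigroup without anomalous pairs maps
additively and strictly monotonically to the reals. -/
theorem exists_hom_real :
    ∃ q : S → ℝ, (∀ x y, q (x * y) = q x + q y) ∧ ∀ x y, x < y → q x < q y := by
  by_cases hp : ∃ c : S, c < c * c
  · exact exists_hom_of_pos hp.choose_spec
  by_cases hn : ∃ c : S, c * c < c
  · obtain ⟨c, hc⟩ := hn
    obtain ⟨q, hadd, hlt⟩ := exists_hom_of_pos (S := Sᵒᵈ) (c := OrderDual.toDual c) hc
    refine ⟨fun x => -q (OrderDual.toDual x), fun x y => ?_, fun x y h => neg_lt_neg (hlt _ _ h)⟩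
    change -q (OrderDual.toDual x * OrderDual.toDual y) = _
    rw [hadd, neg_add]
  push Not at hp hn
  refine ⟨fun _ => 0, by simp, fun x y h => absurd ((mul_le_mul_right_iff y x x).1 ?_) h.not_ge⟩
  have hy : y * y ≤ y := by
    by_contra hy
    exact hp y (lt_of_not_le hy)
  have hx : x ≤ x * x := by
    by_contra hx
    exact hn x (lt_of_not_le hx)
  exact ((mul_right_le_iff_mul_left_le y y x).1 hy).trans hx

end NonAnomalousPreorder

/-- The additive group of the reals, written multiplicatively, as a non-anomalous totally
ordered semigroup in an arbitrary universe. -/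
noncomputable def NATOSemigroup.real : NATOSemigroup where
  carrier := ULift (Multiplicative ℝ)
  mul_lt x y z h := ⟨mul_lt_mul_left (α := Multiplicative ℝ) h z.down,
    mul_lt_mul_right (α := Multiplicative ℝ) h z.down⟩
  nonAnom x y := by
    let f : ULift (Multiplicative ℝ) → ℝ := fun x => x.down.toAdd
    have hf : ∀ x y, f (x * y) = f x + f y := fun _ _ => rfl
    have hlt : ∀ {x y}, x < y → f x < f y := fun h => h
    rintro ⟨hxy, h | h⟩
    · have := nonpos_of_forall_nat_mul_le (a := f x - f y) (b := f y)
        fun n hn => by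
          have := hlt (h n hn)
          rw [map_mpow hf x hn, map_mpow hf y (by omega)] at this
          push_cast at this
          linarith
      linarith [hlt hxy]
    · have := nonpos_of_forall_nat_mul_le (a := f x - f y) (b := -f x)
        fun n hn => by
          have := hlt (h n hn)
          rw [map_mpow hf x (by omega), map_mpow hf y hn] at this
          push_cast at this
          linarith
      linarith [hlt hxy]

/-- A non-anomalous weakly ordered semigroup admits a morphism to a non-anomalous
totally ordered semigroup. -/
theorem stmt8 {W : Type*} [Semigroup W] (r : W → W → Prop)
    (hA1 : ∀ x y z : W, r x y → r y z → r x z)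
    (hA2 : ∀ x y : W, r x y → ¬ r y x)
    (hA3 : ∀ x y z : W, (¬ r x y ∧ ¬ r y x) → (¬ r y z ∧ ¬ r z y) → (¬ r x z ∧ ¬ r z x))
    (hA5 : ∀ x y z : W, (r x y ↔ r (x * z) (y * z)) ∧ (r x y ↔ r (z * x) (z * y)))
    (hna : ¬ ∃ x y : W, r y x ∧
      ((∀ n : ℕ, 1 ≤ n → r (mpow x n) (mpow y (n + 1))) ∨
       (∀ n : ℕ, 1 ≤ n → r (mpow x (n + 1)) (mpow y n)))) :
    ∃ (V : NATOSemigroup) (q : W → V.carrier),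
      (∀ x y : W, q (x * y) = q x * q y) ∧ (∀ x y : W, r x y → q x < q y) := by
  let _ : Preorder W :=
    { le := fun x y => ¬ r y x
      lt := r
      le_refl := fun x h => hA2 x x h h
      le_trans := fun x y z hxy hyz hzx => by
        by_cases h : r x y
        · exact hyz (hA1 z x y hzx h)
        by_cases h' : r y z
        · exact hxy (hA1 y z x h' hzx)
        exact (hA3 x y z ⟨h, hxy⟩ ⟨h', hyz⟩).2 hzx
      lt_iff_le_not_ge := fun x y => ⟨fun h => ⟨hA2 x y h, not_not.2 h⟩, fun h => not_not.1 h.2⟩ }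
  have : NonAnomalousPreorder W :=
    { total := fun x y => or_iff_not_imp_left.2 fun h => hA2 y x (not_not.1 h)
      mul_le_mul_left_iff := fun x y z => not_congr (hA5 y x z).2.symm
      mul_le_mul_right_iff := fun x y z => not_congr (hA5 y x z).1.symm
      exists_mpow_succ_le := fun x y h => by
        by_contra! H
        exact hna ⟨y, x, h, .inl fun n hn => not_not.1 (H n hn)⟩
      exists_mpow_le_succ := fun x y h => by
        by_contra! H
        exact hna ⟨y, x, h, .inr fun n hn => not_not.1 (H n hn)⟩ }
  obtain ⟨q, hadd, hlt⟩ := NonAnomalousPreorder.exists_hom_real W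
  exact ⟨NATOSemigroup.real, fun x => ULift.up (Multiplicative.ofAdd (q x)),
    fun x y => congrArg (fun t => ULift.up (Multiplicative.ofAdd t)) (hadd x y), hlt⟩
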